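/- Let (H,σ) be a difference field of characteristic zero and let H ⊆ H(t₁) ⊆ H(t₁)(t₂) ⊆ … ⊆ H(t₁)…(t_e) be a polynomial ΠΣ*-extension inside an ambient difference field: each t_i is transcendental over H(t₁,…,t_{i−1}), const(H(t₁,…,t_i),σ) = const(H,σ), and for every i either σ(t_i) − t_i ∈ H[t₁,…,t_{i−1}] (the subring generated by H and t₁,…,t_{i−1}) or (t_i ≠ 0 and σ(t_i)/t_i ∈ H). Then for every g ∈ H(t₁,…,t_e): σ(g) − g ∈ H[t₁,…,t_e] if and only if g ∈ H[t₁,…,t_e]. -/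

import Mathlib

/-- The subfield generated by the subfield `H` and a set `S` of elements. -/
def adjS {E : Type*} [Field E] (H : Subfield E) (S : Set E) : Subfield E :=
  Subfield.closure ((H : Set E) ∪ S)

/-- The subring generated by the subfield `H` and a set `S` of elements
(`H[t₁,…,t_e]`). -/
def ringAdjS {E : Type*} [Field E] (H : Subfield E) (S : Set E) : Subring E :=
  Subring.closure ((H : Set E) ∪ S)

/-- The set of constants of the subfield `L` with respect to the automorphism `σ`. -/
def constSet {E : Type*} [Field E] (σ : E ≃+* E) (L : Subfield E) : Set E :=
  {c : E | c ∈ L ∧ σ c = c}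

open Polynomial

section Extension

variable {E : Type*} [Field E]

/-- The restriction of a field endomorphism to an invariant subfield. -/
def restrictEnd (σ : E →+* E) (F : Subfield E) (hF : ∀ x ∈ F, σ x ∈ F) : F →+* F :=
  (σ.comp F.subtype).codRestrict F fun x => hF x x.2

/-- The endomorphism of `F[X]` acting as `σ` on the coefficients and sending `X` to
`α * X + b`. -/
noncomputable def skewMap {F : Type*} [Field F] (σ : F →+* F) (α b : F) : F[X] →+* F[X] :=
  eval₂RingHom (C.comp σ) (C α * X + C b)

lemma skewMap_eq_comp {F : Type*} [Field F] (σ : F →+* F) (α b : F) (p : F[X]) :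
    skewMap σ α b p = (p.map σ).comp (C α * X + C b) := by
  simp [skewMap, Polynomial.comp, eval₂_map]

lemma natDegree_skewMap {F : Type*} [Field F] (σ : F →+* F) {α : F} (hα : α ≠ 0) (b : F)
    (p : F[X]) : (skewMap σ α b p).natDegree = p.natDegree := by
  rw [skewMap_eq_comp, natDegree_comp, natDegree_map, natDegree_linear hα, mul_one]

lemma leadingCoeff_skewMap {F : Type*} [Field F] (σ : F →+* F) {α : F} (hα : α ≠ 0) (b : F)
    (p : F[X]) :
    (skewMap σ α b p).leadingCoeff = σ p.leadingCoeff * α ^ p.natDegree := by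
  rw [skewMap_eq_comp, leadingCoeff_comp (by rw [natDegree_linear hα]; exact one_ne_zero),
    leadingCoeff_map, natDegree_map, leadingCoeff_linear hα]

lemma coeff_skewMap_zero {F : Type*} [Field F] (σ : F →+* F) (α : F) (p : F[X]) (i : ℕ) :
    (skewMap σ α 0 p).coeff i = σ (p.coeff i) * α ^ i := by
  rw [skewMap_eq_comp, C_0, add_zero, comp_C_mul_X_coeff, coeff_map]

lemma algebraMap_subfield_apply (F : Subfield E) (x : F) : algebraMap F E x = x := rfl

lemma aeval_skewMap (σ : E →+* E) (F : Subfield E) (hF : ∀ x ∈ F, σ x ∈ F) (α b : F) {t : E}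
    (ht : σ t = α * t + b) (p : F[X]) :
    aeval t (skewMap (restrictEnd σ F hF) α b p) = σ (aeval t p) := by
  have hlin : aeval t (C α * X + C b) = σ t := by
    simp [ht, algebraMap_subfield_apply]
  rw [skewMap_eq_comp, aeval_comp, hlin, aeval_def, eval₂_map, aeval_def, hom_eval₂]
  rfl

lemma exists_eq_mul_coprime {F : Type*} [Field F] (r : F[X]) {s : F[X]} (hs : s ≠ 0) :
    ∃ d p q : F[X], IsCoprime p q ∧ q.Monic ∧ r = d * p ∧ s = d * q := by
  classical
  have hd : EuclideanDomain.gcd r s ≠ 0 := fun h => hs (EuclideanDomain.gcd_eq_zero_iff.1 h).2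
  obtain ⟨r', hr⟩ := EuclideanDomain.gcd_dvd_left r s
  obtain ⟨s', hs'⟩ := EuclideanDomain.gcd_dvd_right r s
  set d := EuclideanDomain.gcd r s with hd'
  have hcop : IsCoprime r' s' := by
    refine ⟨EuclideanDomain.gcdA r s, EuclideanDomain.gcdB r s, mul_left_cancel₀ hd ?_⟩
    calc d * (EuclideanDomain.gcdA r s * r' + EuclideanDomain.gcdB r s * s')
        = (d * r') * EuclideanDomain.gcdA r s + (d * s') * EuclideanDomain.gcdB r s := by ring
      _ = d * 1 := by rw [← hr, ← hs', mul_one, hd', EuclideanDomain.gcd_eq_gcd_ab]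
  have hs0 : s' ≠ 0 := by
    rintro rfl
    exact hs (by rw [hs', mul_zero])
  have hl : s'.leadingCoeff ≠ 0 := leadingCoeff_ne_zero.2 hs0
  have hC : C s'.leadingCoeff * C s'.leadingCoeff⁻¹ = 1 := by
    rw [← C_mul, mul_inv_cancel₀ hl, C_1]
  have hunit : IsUnit (C s'.leadingCoeff⁻¹) := isUnit_C.2 (inv_ne_zero hl).isUnit
  refine ⟨d * C s'.leadingCoeff, r' * C s'.leadingCoeff⁻¹, s' * C s'.leadingCoeff⁻¹,
    (isCoprime_mul_unit_right hunit _ _).2 hcop, monic_mul_leadingCoeff_inv hs0, ?_, ?_⟩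
  · rw [mul_mul_mul_comm, hC, mul_one, ← hr]
  · rw [mul_mul_mul_comm, hC, mul_one, ← hs']

lemma exists_coprime_of_mem_closure (F : Subfield E) {t : E} (ht : Transcendental F t) {g : E}
    (hg : g ∈ Subfield.closure ((F : Set E) ∪ {t})) :
    ∃ p q : F[X], IsCoprime p q ∧ q.Monic ∧ g * aeval t q = aeval t p := by
  have hle : Subfield.closure ((F : Set E) ∪ {t}) ≤
      (IntermediateField.adjoin F {t}).toSubfield := by
    rw [Subfield.closure_le]
    rintro x (hx | hx)
    · exact (IntermediateField.adjoin F {t}).algebraMap_mem ⟨x, hx⟩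
    · exact IntermediateField.subset_adjoin F {t} hx
  obtain ⟨r, s, rfl⟩ := (IntermediateField.mem_adjoin_simple_iff F g).1 (hle hg)
  have hinj := transcendental_iff_injective.1 ht
  rcases eq_or_ne s 0 with rfl | hs
  · exact ⟨0, 1, isCoprime_one_right, monic_one, by simp⟩
  obtain ⟨d, p, q, hpq, hq, hr, hs'⟩ := exists_eq_mul_coprime r hs
  refine ⟨p, q, hpq, hq, ?_⟩
  have hs0 : aeval t s ≠ 0 := fun h => hs (hinj (by rw [h, map_zero]))
  rw [hs', map_mul] at hs0
  rw [hr, hs', map_mul, map_mul, mul_div_mul_left _ _ (left_ne_zero_of_mul hs0),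
    div_mul_cancel₀ _ (right_ne_zero_of_mul hs0)]

lemma aeval_mem_subfield_closure (F : Subfield E) (t : E) (p : F[X]) :
    aeval t p ∈ Subfield.closure ((F : Set E) ∪ {t}) := by
  rw [aeval_eq_sum_range]
  refine sum_mem fun i _ => ?_
  rw [Algebra.smul_def]
  have hi : (p.coeff i : E) ∈ Subfield.closure ((F : Set E) ∪ {t}) :=
    Subfield.subset_closure (Or.inl (p.coeff i).2)
  have ht : t ∈ Subfield.closure ((F : Set E) ∪ {t}) := Subfield.subset_closure (Or.inr rfl)
  exact mul_mem hi (pow_mem ht i)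

lemma exists_of_mem_closure (F : Subfield E) (A : Subring E) (hAF : A ≤ F.toSubring) {t x : E}
    (hx : x ∈ Subring.closure ((A : Set E) ∪ {t})) :
    ∃ P : F[X], (∀ i, (P.coeff i : E) ∈ A) ∧ aeval t P = x := by
  have hle : Subring.closure ((A : Set E) ∪ {t}) ≤ (eval₂RingHom A.subtype t).range := by
    rw [Subring.closure_le]
    rintro y (hy | rfl)
    · exact ⟨C ⟨y, hy⟩, by simp⟩
    · exact ⟨X, by simp⟩
  obtain ⟨Q, rfl⟩ := hle hx
  refine ⟨Q.map (A.subtype.codRestrict F fun a => hAF a.2), fun i => ?_, ?_⟩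
  · rw [coeff_map]
    exact (Q.coeff i).2
  · rw [aeval_def, eval₂_map]
    rfl

lemma aeval_mem_closure_iff (F : Subfield E) (A : Subring E) (hAF : A ≤ F.toSubring) {t : E}
    (ht : Transcendental F t) (P : F[X]) :
    aeval t P ∈ Subring.closure ((A : Set E) ∪ {t}) ↔ ∀ i, (P.coeff i : E) ∈ A := by
  constructor
  · intro h
    obtain ⟨Q, hQ, hQP⟩ := exists_of_mem_closure F A hAF h
    have hQP' : Q = P := transcendental_iff_injective.1 ht hQP
    rwa [← hQP']
  · intro h
    rw [aeval_eq_sum_range]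
    refine sum_mem fun i _ => ?_
    rw [Algebra.smul_def]
    have hi : (P.coeff i : E) ∈ Subring.closure ((A : Set E) ∪ {t}) :=
      Subring.subset_closure (Or.inl (h i))
    have ht : t ∈ Subring.closure ((A : Set E) ∪ {t}) := Subring.subset_closure (Or.inr rfl)
    exact mul_mem hi (pow_mem ht i)

/-- If `a * σ g - g` is a polynomial in `t`, then the reduced denominator `q` of `g` is mapped by
`σ` to an associate of itself. -/
lemma skewMap_denom (σ : E →+* E) (F : Subfield E) (hF : ∀ x ∈ F, σ x ∈ F) {α b : F}
    (hα : α ≠ 0) {t : E} (htr : Transcendental F t) (ht : σ t = α * t + b) {a : F} (ha : a ≠ 0)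
    {g : E} {p q r : F[X]} (hpq : IsCoprime p q) (hq : q.Monic)
    (hg : g * aeval t q = aeval t p) (hr : a * σ g - g = aeval t r) :
    skewMap (restrictEnd σ F hF) α b q = C (α ^ q.natDegree) * q := by
  set Φ := skewMap (restrictEnd σ F hF) α b with hΦ
  have key : C a * Φ p * q = (r * q + p) * Φ q := by
    apply transcendental_iff_injective.1 htr
    simp only [map_mul, map_add, hΦ, aeval_skewMap σ F hF α b ht, ← hg, aeval_C,
      algebraMap_subfield_apply, ← hr]
    ring
  have hdvd : Φ q ∣ q := by
    have h1 : Φ q ∣ Φ p * (C a * q) := ⟨r * q + p, by rw [mul_comm _ (r * q + p), ← key]; ring⟩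
    have h2 := (hpq.map Φ).symm.dvd_of_dvd_mul_left h1
    have hCa : IsUnit (C a) := isUnit_C.2 ha.isUnit
    rwa [hCa.dvd_mul_left] at h2
  have hdeg : (Φ q).natDegree = q.natDegree := natDegree_skewMap _ hα b q
  have hlead : (Φ q).leadingCoeff = α ^ q.natDegree := by
    rw [hΦ, leadingCoeff_skewMap _ hα, hq.leadingCoeff, map_one, one_mul]
  have h0 : Φ q ≠ 0 := by
    rw [← leadingCoeff_ne_zero, hlead]
    exact pow_ne_zero _ hα
  obtain ⟨u, hu⟩ := hdvd
  have hu0 : u ≠ 0 := by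
    rintro rfl
    exact hq.ne_zero (by simpa using hu)
  have hud : u.natDegree = 0 := by
    have := congrArg natDegree hu
    rw [natDegree_mul h0 hu0, hdeg] at this
    omega
  rw [eq_C_of_natDegree_eq_zero hud] at hu
  have hl := congrArg leadingCoeff hu
  rw [leadingCoeff_mul, hlead, hq.leadingCoeff, leadingCoeff_C] at hl
  calc Φ q = C (α ^ q.natDegree) * (Φ q * C (u.coeff 0)) := by
        rw [mul_left_comm, ← C_mul, ← hl, C_1, mul_one]
    _ = C (α ^ q.natDegree) * q := by rw [← hu]

/-- Every solution `g ∈ F` of `a * σ g - g ∈ A` lies in `A` as soon as all solutions of the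
homogeneous equation `a * σ h = h` do. -/
def TwistedClosed (σ : E →+* E) (H F : Subfield E) (A : Subring E) : Prop :=
  ∀ a ∈ H, a ≠ 0 → (∀ h ∈ F, a * σ h = h → h ∈ A) →
    ∀ g ∈ F, a * σ g - g ∈ A → g ∈ A

lemma TwistedClosed.adjoin_sum {σ : E →+* E} {H F : Subfield E} {A : Subring E}
    (hc : TwistedClosed σ H F A) (hHA : H.toSubring ≤ A) (hAF : A ≤ F.toSubring)
    (hA : ∀ x ∈ A, σ x ∈ A) (hF : ∀ x ∈ F, σ x ∈ F) {t : E} (htr : Transcendental F t)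
    (hconst : ∀ c ∈ Subfield.closure ((F : Set E) ∪ {t}), σ c = c → c ∈ F)
    (ht : σ t - t ∈ A) :
    TwistedClosed σ H (Subfield.closure ((F : Set E) ∪ {t}))
      (Subring.closure ((A : Set E) ∪ {t})) := by
  intro a haH ha hsol g hg hr
  have hinj := transcendental_iff_injective.1 htr
  have haA : a ∈ A := hHA haH
  have haF : a ∈ F := hAF haA
  set b : F := ⟨σ t - t, hAF ht⟩ with hb
  have ht' : σ t = ((1 : F) : E) * t + b := by simp [hb]
  set Φ := skewMap (restrictEnd σ F hF) 1 b with hΦ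
  have hΦe : ∀ p, aeval t (Φ p) = σ (aeval t p) := aeval_skewMap σ F hF 1 b ht'
  have hFmem : ∀ x ∈ F, x ∈ Subfield.closure ((F : Set E) ∪ {t}) := fun x hx =>
    Subfield.subset_closure (Or.inl hx)
  have hAmem : ∀ x ∈ A, x ∈ Subring.closure ((A : Set E) ∪ {t}) := fun x hx =>
    Subring.subset_closure (Or.inl hx)
  have htA : t ∈ Subring.closure ((A : Set E) ∪ {t}) := Subring.subset_closure (Or.inr rfl)
  have hσt : σ t ∈ Subring.closure ((A : Set E) ∪ {t}) := by
    have := add_mem (hAmem _ ht) htA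
    rwa [sub_add_cancel] at this
  have hpoly := aeval_mem_subfield_closure F t
  have hbase : ∀ h ∈ F, a * σ h = h → h ∈ A := fun h hh hh' => by
    have h1 := hsol h (hFmem h hh) hh'
    have h2 := (aeval_mem_closure_iff F A hAF htr (C ⟨h, hh⟩)).1 (by rw [aeval_C]; exact h1) 0
    simpa using h2
  obtain ⟨p, q, hpq, hq, hgq⟩ := exists_coprime_of_mem_closure F htr hg
  obtain ⟨r, -, hr'⟩ := exists_of_mem_closure F A hAF hr
  have hden := skewMap_denom σ F hF one_ne_zero htr ht' (a := ⟨a, haF⟩)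
    (fun h => ha (congrArg Subtype.val h)) hpq hq hgq hr'.symm
  rw [one_pow, C_1, one_mul] at hden
  have hq1 : q = 1 := by
    have h1 : aeval t q ∈ F := hconst _ (hpoly q) (by rw [← hΦe, hden])
    have h2 : q = C ⟨aeval t q, h1⟩ := hinj (by rw [aeval_C]; rfl)
    exact (Monic.natDegree_eq_zero hq).1 (by rw [h2, natDegree_C])
  rw [hq1, map_one, mul_one] at hgq
  clear hr' hden hpq hg
  subst hgq
  have main : ∀ n : ℕ, ∀ p : F[X], p.natDegree < n →
      a * σ (aeval t p) - aeval t p ∈ Subring.closure ((A : Set E) ∪ {t}) →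
      aeval t p ∈ Subring.closure ((A : Set E) ∪ {t}) := by
    intro n
    induction n with
    | zero => intro p hp; omega
    | succ n ih =>
      intro p hp hpA
      have hlead : (p.leadingCoeff : E) ∈ A := by
        refine hc a haH ha hbase _ p.leadingCoeff.2 ?_
        have h1 : a * σ (aeval t p) - aeval t p = aeval t (C ⟨a, haF⟩ * Φ p - p) := by
          rw [map_sub, map_mul, hΦe, aeval_C]; rfl
        rw [h1] at hpA
        have h2 := (aeval_mem_closure_iff F A hAF htr _).1 hpA p.natDegree
        have h3 : (Φ p).coeff p.natDegree = restrictEnd σ F hF p.leadingCoeff := by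
          have := leadingCoeff_skewMap (restrictEnd σ F hF) one_ne_zero b p
          rwa [leadingCoeff, natDegree_skewMap _ one_ne_zero, one_pow, mul_one] at this
        rw [coeff_sub, coeff_C_mul, h3] at h2
        exact h2
      have hsplit : aeval t p = aeval t p.eraseLead + p.leadingCoeff * t ^ p.natDegree := by
        conv_lhs => rw [← eraseLead_add_monomial_natDegree_leadingCoeff p]
        rw [map_add, aeval_monomial]
        rfl
      have hmono : (p.leadingCoeff : E) * t ^ p.natDegree ∈
          Subring.closure ((A : Set E) ∪ {t}) := mul_mem (hAmem _ hlead) (pow_mem htA _)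
      by_cases hd : p.natDegree = 0
      · rw [hd, pow_zero, mul_one] at hmono
        rw [eq_C_of_natDegree_eq_zero hd, aeval_C, ← hd]
        exact hmono
      · rw [hsplit]
        refine add_mem (ih _ ?_ ?_) hmono
        · have := eraseLead_natDegree_le p
          omega
        · have h1 : a * σ (aeval t p.eraseLead) - aeval t p.eraseLead =
              (a * σ (aeval t p) - aeval t p) -
                (a * (σ p.leadingCoeff * σ t ^ p.natDegree) -
                  p.leadingCoeff * t ^ p.natDegree) := by
            rw [hsplit, map_add, map_mul, map_pow]; ring
          rw [h1]
          exact sub_mem hpA (sub_mem (mul_mem (hAmem _ haA)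
            (mul_mem (hAmem _ (hA _ hlead)) (pow_mem hσt _))) hmono)
  exact main _ p (Nat.lt_succ_self _) hr

lemma TwistedClosed.adjoin_prod {σ : E →+* E} {H F : Subfield E} {A : Subring E}
    (hc : TwistedClosed σ H F A) (hHA : H.toSubring ≤ A) (hAF : A ≤ F.toSubring)
    (hF : ∀ x ∈ F, σ x ∈ F) {t : E} (htr : Transcendental F t)
    (hconst : ∀ c ∈ Subfield.closure ((F : Set E) ∪ {t}), σ c = c → c ∈ F)
    {α : E} (hαH : α ∈ H) (ht0 : t ≠ 0) (ht : σ t = α * t) :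
    TwistedClosed σ H (Subfield.closure ((F : Set E) ∪ {t}))
      (Subring.closure ((A : Set E) ∪ {t})) := by
  intro a haH ha hsol g hg hr
  have hinj := transcendental_iff_injective.1 htr
  have haF : a ∈ F := hAF (hHA haH)
  have hα : α ≠ 0 := by
    rintro rfl
    exact ht0 (σ.injective (by rw [ht, zero_mul, map_zero]))
  set α' : F := ⟨α, hAF (hHA hαH)⟩ with hα'
  have hα0 : α' ≠ 0 := fun h => hα (congrArg Subtype.val h)
  have ht' : σ t = (α' : E) * t + (0 : F) := by simp [hα', ht]
  set Φ := skewMap (restrictEnd σ F hF) α' 0 with hΦ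
  have hΦe : ∀ p, aeval t (Φ p) = σ (aeval t p) := aeval_skewMap σ F hF α' 0 ht'
  have hFmem : ∀ x ∈ F, x ∈ Subfield.closure ((F : Set E) ∪ {t}) := fun x hx =>
    Subfield.subset_closure (Or.inl hx)
  have htmem : t ∈ Subfield.closure ((F : Set E) ∪ {t}) := Subfield.subset_closure (Or.inr rfl)
  have hpoly := aeval_mem_subfield_closure F t
  obtain ⟨p, q, hpq, hq, hgq⟩ := exists_coprime_of_mem_closure F htr hg
  obtain ⟨r, hrA, hr'⟩ := exists_of_mem_closure F A hAF hr
  have hden := skewMap_denom σ F hF hα0 htr ht' (a := ⟨a, haF⟩)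
    (fun h => ha (congrArg Subtype.val h)) hpq hq hgq hr'.symm
  obtain ⟨n, hqn⟩ : ∃ n, q = X ^ n := by
    have hσq : σ (aeval t q) = α ^ q.natDegree * aeval t q := by
      rw [← hΦe, hden, map_mul, aeval_C]; rfl
    have h1 : aeval t q / t ^ q.natDegree ∈ F := by
      refine hconst _ (div_mem (hpoly q) (pow_mem htmem _)) ?_
      rw [map_div₀, hσq, map_pow, ht, mul_pow]
      field_simp
    have h2 : q = C ⟨_, h1⟩ * X ^ q.natDegree := hinj (by
      rw [map_mul, aeval_C, map_pow, aeval_X]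
      exact (div_mul_cancel₀ _ (pow_ne_zero _ ht0)).symm)
    refine ⟨q.natDegree, ?_⟩
    have h3 := hq.leadingCoeff
    rw [h2, leadingCoeff_mul, leadingCoeff_C, leadingCoeff_X_pow, mul_one] at h3
    conv_lhs => rw [h2, h3, C_1, one_mul]
  subst hqn
  rw [map_pow, aeval_X] at hgq
  have hcoeff : ∀ i, a * (α ^ i / α ^ n) * σ (p.coeff i) - p.coeff i =
      ((r * X ^ n).coeff i : E) := by
    have h1 : C ⟨a, haF⟩ * C (α' ^ n)⁻¹ * Φ p - p = r * X ^ n := hinj (by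
      have : (((α' ^ n)⁻¹ : F) : E) = (α ^ n)⁻¹ := rfl
      simp only [map_sub, map_mul, hΦe, aeval_C, algebraMap_subfield_apply, ← hgq, map_pow, aeval_X, hr', ht, mul_pow, this]
      field_simp)
    intro i
    rw [← h1, coeff_sub, mul_assoc (C _), coeff_C_mul, coeff_C_mul, hΦ, coeff_skewMap_zero]
    change _ = a * ((α ^ n)⁻¹ * (σ (p.coeff i) * α ^ i)) - (p.coeff i : E)
    ring
  have hhom : ∀ i, ∀ h ∈ F, a * (α ^ i / α ^ n) * σ h = h → h ∈ A ∧ (i < n → h = 0) := by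
    intro i h hh hh'
    have h1 : h * t ^ i / t ^ n ∈ Subring.closure ((A : Set E) ∪ {t}) := by
      refine hsol _ (div_mem (mul_mem (hFmem h hh) (pow_mem htmem _)) (pow_mem htmem _)) ?_
      conv_rhs => rw [← hh']
      rw [map_div₀, map_mul, map_pow, map_pow, ht, mul_pow, mul_pow]
      field_simp
    obtain ⟨Q, hQA, hQ⟩ := exists_of_mem_closure F A hAF h1
    have h2 : Q * X ^ n = C ⟨h, hh⟩ * X ^ i := hinj (by
      rw [map_mul, map_mul, hQ, aeval_C, map_pow, map_pow, aeval_X]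
      exact div_mul_cancel₀ _ (pow_ne_zero _ ht0))
    have h3 : (Q * X ^ n).coeff i = ⟨h, hh⟩ := by
      rw [h2, coeff_C_mul, coeff_X_pow_self, mul_one]
    rw [coeff_mul_X_pow'] at h3
    split_ifs at h3 with hin
    · refine ⟨?_, fun h => absurd h (by omega)⟩
      have := hQA (i - n)
      rwa [h3] at this
    · have h0 : h = 0 := (congrArg Subtype.val h3).symm
      exact ⟨h0 ▸ A.zero_mem, fun _ => h0⟩
  have hpA : ∀ i, (p.coeff i : E) ∈ A := fun i => by
    refine hc _ (mul_mem haH (div_mem (pow_mem hαH _) (pow_mem hαH _))) (mul_ne_zero ha (div_ne_zero (pow_ne_zero _ hα) (pow_ne_zero _ hα)))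
      (fun h hh hh' => (hhom i h hh hh').1) _ (p.coeff i).2 ?_
    rw [hcoeff, coeff_mul_X_pow']
    split_ifs
    · exact hrA _
    · exact A.zero_mem
  obtain ⟨p', rfl⟩ : X ^ n ∣ p := by
    rw [X_pow_dvd_iff]
    intro i hi
    refine Subtype.ext ((hhom i _ (p.coeff i).2 ?_).2 hi)
    rw [← sub_eq_zero, hcoeff, coeff_mul_X_pow', if_neg (by omega)]
    rfl
  have hg' : g = aeval t p' := by
    rw [map_mul, map_pow, aeval_X, mul_comm] at hgq
    exact mul_left_cancel₀ (pow_ne_zero _ ht0) hgq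
  rw [hg', aeval_mem_closure_iff F A hAF htr]
  intro i
  have := hpA (i + n)
  rwa [coeff_X_pow_mul] at this

end Extension

section Tower

lemma image_lt_succ {α : Type*} (t : ℕ → α) (i : ℕ) :
    t '' {j | j < i + 1} = t '' {j | j < i} ∪ {t i} := by
  rw [← Set.image_singleton, ← Set.image_union]
  congr 1
  ext j
  simp only [Set.mem_ofPred_eq, Set.mem_union, Set.mem_singleton_iff]
  omega

variable {E : Type*} [Field E] (H : Subfield E)

lemma subset_adjS (S : Set E) : H ≤ adjS H S := fun _ hx =>
  Subfield.subset_closure (Or.inl hx)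

lemma le_ringAdjS (S : Set E) : H.toSubring ≤ ringAdjS H S := fun _ hx =>
  Subring.subset_closure (Or.inl hx)

lemma ringAdjS_le_adjS (S : Set E) : ringAdjS H S ≤ (adjS H S).toSubring :=
  Subring.closure_le.2 Subfield.subset_closure

lemma adjS_succ (t : ℕ → E) (i : ℕ) : adjS H (t '' {j | j < i + 1}) =
    Subfield.closure ((adjS H (t '' {j | j < i}) : Set E) ∪ {t i}) := by
  rw [image_lt_succ, adjS, ← Set.union_assoc, Subfield.closure_union,
    Subfield.closure_union (adjS H (t '' {j | j < i}) : Set E), Subfield.closure_eq, adjS]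

lemma ringAdjS_succ (t : ℕ → E) (i : ℕ) : ringAdjS H (t '' {j | j < i + 1}) =
    Subring.closure ((ringAdjS H (t '' {j | j < i}) : Set E) ∪ {t i}) := by
  rw [image_lt_succ, ringAdjS, ← Set.union_assoc, Subring.closure_union,
    Subring.closure_union (ringAdjS H (t '' {j | j < i}) : Set E), Subring.closure_eq, ringAdjS]

lemma map_mem_ringAdjS {σ : E →+* E} (hH : ∀ x ∈ H, σ x ∈ H) {e : ℕ} {t : ℕ → E}
    (hPS : ∀ i < e, σ (t i) - t i ∈ ringAdjS H (t '' {j | j < i}) ∨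
        (t i ≠ 0 ∧ σ (t i) / t i ∈ H)) {i : ℕ} (hi : i ≤ e) :
    ∀ x ∈ ringAdjS H (t '' {j | j < i}), σ x ∈ ringAdjS H (t '' {j | j < i}) := by
  suffices h : ringAdjS H (t '' {j | j < i}) ≤ (ringAdjS H (t '' {j | j < i})).comap σ from h
  refine Subring.closure_le.2 ?_
  rintro x (hx | ⟨j, hj, rfl⟩)
  · exact le_ringAdjS H _ (hH x hx)
  have hj' : j < i := hj
  have htj : t j ∈ ringAdjS H (t '' {j | j < i}) := Subring.subset_closure (Or.inr ⟨j, hj, rfl⟩)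
  change σ (t j) ∈ ringAdjS H (t '' {j | j < i})
  rcases hPS j (by omega) with h | ⟨h0, h⟩
  · have hmono : ringAdjS H (t '' {k | k < j}) ≤ ringAdjS H (t '' {k | k < i}) :=
      Subring.closure_mono (Set.union_subset_union_right _
        (Set.image_mono fun k (hk : k < j) => hk.trans hj'))
    have := add_mem (hmono h) htj
    rwa [sub_add_cancel] at this
  · have := mul_mem (le_ringAdjS H (t '' {j | j < i}) h) htj
    rwa [div_mul_cancel₀ _ h0] at this

lemma map_mem_adjS {σ : E →+* E} {S : Set E} (h : ∀ x ∈ ringAdjS H S, σ x ∈ ringAdjS H S) :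
    ∀ x ∈ adjS H S, σ x ∈ adjS H S := by
  suffices h : adjS H S ≤ (adjS H S).comap σ from h
  exact Subfield.closure_le.2 fun x hx => ringAdjS_le_adjS H S (h x (Subring.subset_closure hx))

lemma twistedClosed_tower {σ : E →+* E} (hH : ∀ x ∈ H, σ x ∈ H) {e : ℕ} {t : ℕ → E}
    (htr : ∀ i < e, Transcendental (adjS H (t '' {j | j < i})) (t i))
    (hconst : ∀ i ≤ e, ∀ c ∈ adjS H (t '' {j | j < i}), σ c = c → c ∈ H)
    (hPS : ∀ i < e, σ (t i) - t i ∈ ringAdjS H (t '' {j | j < i}) ∨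
        (t i ≠ 0 ∧ σ (t i) / t i ∈ H)) (i : ℕ) (hi : i ≤ e) :
    TwistedClosed σ H (adjS H (t '' {j | j < i})) (ringAdjS H (t '' {j | j < i})) := by
  induction i with
  | zero =>
    intro a _ _ _ g hg _
    simp only [not_lt_zero, Set.ofPred_false, Set.image_empty] at hg ⊢
    rw [adjS, Set.union_empty, Subfield.closure_eq] at hg
    exact le_ringAdjS H _ hg
  | succ i ih =>
    have hA := map_mem_ringAdjS H hH hPS (i := i) (by omega)
    have hF := map_mem_adjS H hA
    have hc : ∀ c ∈ Subfield.closure ((adjS H (t '' {j | j < i}) : Set E) ∪ {t i}),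
        σ c = c → c ∈ adjS H (t '' {j | j < i}) := fun c hc hcσ =>
      subset_adjS H _ (hconst (i + 1) hi c (by rwa [adjS_succ]) hcσ)
    rw [adjS_succ, ringAdjS_succ]
    rcases hPS i (by omega) with h | ⟨h0, h⟩
    · exact (ih (by omega)).adjoin_sum (le_ringAdjS H _) (ringAdjS_le_adjS H _) hA hF
        (htr i (by omega)) hc h
    · exact (ih (by omega)).adjoin_prod (le_ringAdjS H _) (ringAdjS_le_adjS H _) hF
        (htr i (by omega)) hc h h0 (div_mul_cancel₀ _ h0).symm

end Tower

/-- Polynomial closure property in polynomial ΠΣ*-extensions: for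
`g ∈ H(t₁,…,t_e)` one has `σ(g) - g ∈ H[t₁,…,t_e]` iff `g ∈ H[t₁,…,t_e]`. -/
theorem polynomial_closure {E : Type*} [Field E] [CharZero E] (σ : E ≃+* E)
    (H : Subfield E) (hH : H.map (σ : E →+* E) = H)
    (e : ℕ) (t : ℕ → E)
    (htr : ∀ i < e, Transcendental (adjS H (t '' {j | j < i})) (t i))
    (hconst : ∀ i ≤ e, constSet σ (adjS H (t '' {j | j < i})) = constSet σ H)
    (hPS : ∀ i < e, σ (t i) - t i ∈ ringAdjS H (t '' {j | j < i}) ∨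
        (t i ≠ 0 ∧ σ (t i) / t i ∈ H)) :
    ∀ g ∈ adjS H (t '' {j | j < e}),
      (σ g - g ∈ ringAdjS H (t '' {j | j < e}) ↔ g ∈ ringAdjS H (t '' {j | j < e})) := by
  have hH' : ∀ x ∈ H, (σ : E →+* E) x ∈ H := fun x hx => by
    have h : (σ : E →+* E) x ∈ H.map (σ : E →+* E) := ⟨x, hx, rfl⟩
    rwa [hH] at h
  have hconst' : ∀ i ≤ e, ∀ c ∈ adjS H (t '' {j | j < i}), (σ : E →+* E) c = c → c ∈ H :=
    fun i hi c hc hcσ => ((hconst i hi).subset ⟨hc, hcσ⟩).1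
  intro g hg
  constructor
  · intro h
    refine twistedClosed_tower H hH' htr hconst' hPS e le_rfl 1 H.one_mem one_ne_zero
      (fun c hc hcσ => le_ringAdjS H _ (hconst' e le_rfl c hc (by rwa [one_mul] at hcσ))) g hg ?_
    rwa [one_mul]
  · intro h
    exact sub_mem (map_mem_ringAdjS H hH' hPS le_rfl g h) h
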